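/- arXiv:2302.05741 — 4 statements merged into one kernel-verified Lean document; each statement's English description precedes it below -/
import Mathlib

section
/- Let (u,v) be a lasso over a finite alphabet Σ (u,v finite words with v nonempty) and φ an LTL formula over Σ. Then for every 1 ≤ i ≤ |u|, the position-based relation satisfies (u,v),(i,_) ⊨ φ if and only if u[i..]·v^ω ⊨ φ (where u[i..] is the suffix of u from position i), and for every 1 ≤ j ≤ |v|, (u,v),(_,j) ⊨ φ if and only if v[j..]·v^ω ⊨ φ. In particular, for nonempty u, (u,v),(1,_) ⊨ φ if and only if uv^ω ⊨ φ. -/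
/-!
Correctness of the position-based LTL semantics on lassos: the relation at a
prefix position `(i,_)` matches satisfaction on `u[i..]·v^ω`, and at a loop
position `(_,j)` matches satisfaction on `v[j..]·v^ω`.
-/

namespace Stmt9

/-- LTL formulas over letters `ℕ`. -/
inductive LTL : Type where
  | atom : ℕ → LTL
  | and : LTL → LTL → LTL
  | or : LTL → LTL → LTL
  | not : LTL → LTL
  | X : LTL → LTL
  | U : LTL → LTL → LTL

/-- Satisfaction of an LTL formula on an infinite word `w : ℕ → ℕ`
(positions starting at `0`). -/
def LTL.sat (w : ℕ → ℕ) : LTL → Prop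
  | .atom a => w 0 = a
  | .and φ ψ => φ.sat w ∧ ψ.sat w
  | .or φ ψ => φ.sat w ∨ ψ.sat w
  | .not φ => ¬ φ.sat w
  | .X φ => φ.sat (fun n => w (n + 1))
  | .U φ ψ => ∃ k, ψ.sat (fun n => w (n + k)) ∧ ∀ j < k, φ.sat (fun n => w (n + j))

/-- The infinite periodic word `u·v^ω` denoted by the lasso `(u, v)`
(meaningful when `v ≠ []`). -/
def lassoWord (u v : List ℕ) : ℕ → ℕ := fun n =>
  if n < u.length then u.getD n 0 else v.getD ((n - u.length) % v.length) 0

/-- The position-based satisfaction relation on a lasso `(u,v)`: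
`Sum.inl i` is the prefix position `(i,_)` for `1 ≤ i ≤ |u|` and `Sum.inr j`
is the loop position `(_,j)` for `1 ≤ j ≤ |v|` (1-based positions). -/
def lsat (u v : List ℕ) : LTL → (ℕ ⊕ ℕ) → Prop
  | .atom a, Sum.inl i => u.getD (i - 1) 0 = a
  | .atom a, Sum.inr j => v.getD (j - 1) 0 = a
  | .and φ ψ, p => lsat u v φ p ∧ lsat u v ψ p
  | .or φ ψ, p => lsat u v φ p ∨ lsat u v ψ p
  | .not φ, p => ¬ lsat u v φ p
  | .X φ, Sum.inl i =>
      if i < u.length then lsat u v φ (Sum.inl (i + 1)) else lsat u v φ (Sum.inr 1)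
  | .X φ, Sum.inr j => lsat u v φ (Sum.inr (j % v.length + 1))
  | .U φ ψ, Sum.inl i =>
      (∃ i', i ≤ i' ∧ i' ≤ u.length ∧ lsat u v ψ (Sum.inl i') ∧
        ∀ i'', i ≤ i'' → i'' < i' → lsat u v φ (Sum.inl i'')) ∨
      ((∀ i', i ≤ i' → i' ≤ u.length → lsat u v φ (Sum.inl i')) ∧
        ∃ j, 1 ≤ j ∧ j ≤ v.length ∧
          (∀ j', 1 ≤ j' → j' < j → lsat u v φ (Sum.inr j')) ∧
          lsat u v ψ (Sum.inr j))
  | .U φ ψ, Sum.inr j =>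
      ∃ j', 1 ≤ j' ∧ j' ≤ v.length ∧ lsat u v ψ (Sum.inr j') ∧
        ((j ≤ j' ∧ ∀ j'', j ≤ j'' → j'' < j' → lsat u v φ (Sum.inr j'')) ∨
         (j' < j ∧ (∀ j'', 1 ≤ j'' → j'' < j' → lsat u v φ (Sum.inr j'')) ∧
          (∀ j'', j ≤ j'' → j'' ≤ v.length → lsat u v φ (Sum.inr j''))))

theorem lassoWord_period (u v : List ℕ) (n : ℕ) :
    lassoWord u v (u.length + n + v.length) = lassoWord u v (u.length + n) := by
  unfold lassoWord
  rw [if_neg (by omega), if_neg (by omega)]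
  have h1 : u.length + n + v.length - u.length = n + v.length := by omega
  have h2 : u.length + n - u.length = n := by omega
  rw [h1, h2, Nat.add_mod_right]

theorem lassoWord_dropU (u v : List ℕ) (i : ℕ) (hi : i ≤ u.length) :
    lassoWord (u.drop i) v = fun n => lassoWord u v (n + i) := by
  funext n
  unfold lassoWord
  simp only [List.length_drop]
  by_cases h : n + i < u.length
  · rw [if_pos (by omega), if_pos h]
    simp [List.getD_eq_getElem?_getD, List.getElem?_drop, Nat.add_comm]
  · rw [if_neg (by omega), if_neg h]
    have : n - (u.length - i) = n + i - u.length := by omega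
    rw [this]

theorem lassoWord_dropV (u v : List ℕ) (j : ℕ) (hj : j ≤ v.length) :
    lassoWord (v.drop j) v = fun n => lassoWord u v (n + (u.length + j)) := by
  rw [lassoWord_dropU v v j hj]
  funext n
  unfold lassoWord
  have h2 : n + (u.length + j) - u.length = n + j := by omega
  rw [if_neg (by omega : ¬ (n + (u.length + j) < u.length)), h2]
  by_cases h : n + j < v.length
  · rw [if_pos h, Nat.mod_eq_of_lt h]
  · rw [if_neg h, Nat.mod_eq_sub_mod (a := n + j) (by omega)]

/-- satisfaction at offset `n` of the lasso word -/
def satAt (u v : List ℕ) (φ : LTL) (n : ℕ) : Prop :=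
  φ.sat (fun m => lassoWord u v (m + n))

theorem satAt_period (u v : List ℕ) (φ : LTL) (n : ℕ) :
    satAt u v φ (u.length + n + v.length) ↔ satAt u v φ (u.length + n) := by
  unfold satAt
  have : (fun m => lassoWord u v (m + (u.length + n + v.length)))
      = (fun m => lassoWord u v (m + (u.length + n))) := by
    funext m
    have := lassoWord_period u v (m + n)
    rw [show m + (u.length + n + v.length) = u.length + (m + n) + v.length by omega, this]
    congr 1; omega
  rw [this]

theorem satAt_U (u v : List ℕ) (φ ψ : LTL) (n : ℕ) :
    satAt u v (.U φ ψ) n ↔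
      ∃ k, n ≤ k ∧ satAt u v ψ k ∧ ∀ j, n ≤ j → j < k → satAt u v φ j := by
  have e : ∀ (χ : LTL) k, χ.sat (fun m => lassoWord u v (m + k + n)) ↔ satAt u v χ (n + k) := by
    intro χ k
    unfold satAt
    have : (fun m => lassoWord u v (m + k + n)) = (fun m => lassoWord u v (m + (n + k))) := by
      funext m; congr 1; omega
    rw [this]
  conv_lhs => unfold satAt
  simp only [LTL.sat, e]
  constructor
  · rintro ⟨k, h1, h2⟩
    refine ⟨n + k, by omega, h1, fun j hj hk => ?_⟩
    have := h2 (j - n) (by omega)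
    rwa [show n + (j - n) = j by omega] at this
  · rintro ⟨k, h0, h1, h2⟩
    refine ⟨k - n, ?_, fun j hj => h2 _ (by omega) (by omega)⟩
    rwa [show n + (k - n) = k by omega]

/-- Minimal witness: within one period. -/
theorem until_min {A B : ℕ → Prop} {p m n : ℕ} (hm : 0 < m)
    (hB : ∀ n, B (p + n + m) ↔ B (p + n))
    (h : ∃ k, n ≤ k ∧ B k ∧ ∀ j, n ≤ j → j < k → A j) :
    ∃ k, n ≤ k ∧ (k < n + m ∨ k < p + m) ∧ B k ∧ ∀ j, n ≤ j → j < k → A j := by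
  classical
  obtain ⟨h0, h1, h2⟩ := Nat.find_spec h
  have hmin := fun k => Nat.find_min (m := k) h
  generalize Nat.find h = k at *
  refine ⟨k, h0, ?_, h1, h2⟩
  by_contra hc
  refine hmin (k - m) (by omega) ⟨by omega, ?_, fun j hj hk => h2 j hj (by omega)⟩
  have := hB (k - m - p)
  rw [show p + (k - m - p) + m = k by omega, show p + (k - m - p) = k - m by omega] at this
  exact this.1 h1

theorem lsat_iff (u v : List ℕ) (hv : 0 < v.length) (φ : LTL) :
    (∀ i, i < u.length → (lsat u v φ (Sum.inl (i + 1)) ↔ satAt u v φ i)) ∧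
    (∀ j, j < v.length → (lsat u v φ (Sum.inr (j + 1)) ↔ satAt u v φ (u.length + j))) := by
  induction φ with
  | atom a =>
    constructor
    · intro i hi
      simp [lsat, satAt, LTL.sat, lassoWord, hi]
    · intro j hj
      simp [lsat, satAt, LTL.sat, lassoWord, Nat.mod_eq_of_lt hj]
  | and φ ψ h1 h2 =>
    exact ⟨fun i hi => and_congr (h1.1 i hi) (h2.1 i hi),
      fun i hi => and_congr (h1.2 i hi) (h2.2 i hi)⟩
  | or φ ψ h1 h2 =>
    exact ⟨fun i hi => or_congr (h1.1 i hi) (h2.1 i hi),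
      fun i hi => or_congr (h1.2 i hi) (h2.2 i hi)⟩
  | not φ h1 =>
    exact ⟨fun i hi => not_congr (h1.1 i hi), fun i hi => not_congr (h1.2 i hi)⟩
  | X φ h1 =>
    have e : ∀ n, satAt u v (.X φ) n ↔ satAt u v φ (n + 1) := by
      intro n
      unfold satAt
      simp only [LTL.sat]
      have : (fun m => lassoWord u v (m + 1 + n)) = (fun m => lassoWord u v (m + (n + 1))) := by
        funext m; congr 1; omega
      rw [this]
    constructor
    · intro i hi
      rw [e]
      simp only [lsat]
      split_ifs with h
      · exact h1.1 _ h
      · rw [h1.2 0 hv, show u.length + 0 = i + 1 by omega]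
    · intro j hj
      rw [e]
      simp only [lsat]
      rw [h1.2 _ (Nat.mod_lt _ hv)]
      by_cases h : j + 1 < v.length
      · rw [Nat.mod_eq_of_lt h]; rfl
      · have h' : j + 1 = v.length := by omega
        rw [h', Nat.mod_self, ← satAt_period, show u.length + 0 + v.length = u.length + j + 1 by omega]
  | U φ ψ h1 h2 =>
    have pA := satAt_period u v φ
    have pB := satAt_period u v ψ
    have key := fun n => (satAt_U u v φ ψ n)
    have hL1 : ∀ i, 1 ≤ i → i ≤ u.length → (lsat u v φ (Sum.inl i) ↔ satAt u v φ (i - 1)) := by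
      intro i a b
      have := h1.1 (i - 1) (by omega)
      rwa [show i - 1 + 1 = i by omega] at this
    have hL2 : ∀ i, 1 ≤ i → i ≤ u.length → (lsat u v ψ (Sum.inl i) ↔ satAt u v ψ (i - 1)) := by
      intro i a b
      have := h2.1 (i - 1) (by omega)
      rwa [show i - 1 + 1 = i by omega] at this
    have hR1 : ∀ i, 1 ≤ i → i ≤ v.length →
        (lsat u v φ (Sum.inr i) ↔ satAt u v φ (u.length + (i - 1))) := by
      intro i a b
      have := h1.2 (i - 1) (by omega)
      rwa [show i - 1 + 1 = i by omega] at this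
    have hR2 : ∀ i, 1 ≤ i → i ≤ v.length →
        (lsat u v ψ (Sum.inr i) ↔ satAt u v ψ (u.length + (i - 1))) := by
      intro i a b
      have := h2.2 (i - 1) (by omega)
      rwa [show i - 1 + 1 = i by omega] at this
    constructor
    · intro i hi
      rw [key]
      simp only [lsat]
      constructor
      · rintro (⟨i', a, b, c, d⟩ | ⟨a, j, b, c, d, e⟩)
        · refine ⟨i' - 1, by omega, (hL2 _ (by omega) b).1 c, fun j hj hk => ?_⟩
          exact (h1.1 j (by omega)).1 (d _ (by omega) (by omega))
        · refine ⟨u.length + (j - 1), by omega, (hR2 _ b c).1 e, fun k hk hk' => ?_⟩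
          by_cases hh : k < u.length
          · exact (h1.1 k hh).1 (a _ (by omega) (by omega))
          · have := (h1.2 (k - u.length) (by omega)).1 (d _ (by omega) (by omega))
            rwa [show u.length + (k - u.length) = k by omega] at this
      · intro h
        obtain ⟨k, a, b, c, d⟩ := until_min hv pB h
        by_cases hh : k < u.length
        · refine Or.inl ⟨k + 1, by omega, by omega, (h2.1 k hh).2 c, fun j hj hk => ?_⟩
          exact (hL1 j (by omega) (by omega)).2 (d _ (by omega) (by omega))
        · refine Or.inr ⟨fun j hj hk => (hL1 j (by omega) hk).2 (d _ (by omega) (by omega)),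
            k - u.length + 1, by omega, by omega, fun j hj hk => ?_, ?_⟩
          · exact (hR1 j hj (by omega)).2 (d _ (by omega) (by omega))
          · refine (h2.2 _ (by omega)).2 ?_
            rwa [show u.length + (k - u.length) = k by omega]
    · intro i hi
      rw [key]
      simp only [lsat]
      constructor
      · rintro ⟨j, a, b, c, (⟨d, e⟩ | ⟨d, e, f⟩)⟩
        · refine ⟨u.length + (j - 1), by omega, (hR2 _ a b).1 c, fun k hk hk' => ?_⟩
          have := (h1.2 (k - u.length) (by omega)).1 (e _ (by omega) (by omega))
          rwa [show u.length + (k - u.length) = k by omega] at this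
        · refine ⟨u.length + (j - 1) + v.length, by omega, (pB _).2 ((hR2 _ a b).1 c),
            fun k hk hk' => ?_⟩
          by_cases hh : k < u.length + v.length
          · have := (h1.2 (k - u.length) (by omega)).1 (f _ (by omega) (by omega))
            rwa [show u.length + (k - u.length) = k by omega] at this
          · have := (h1.2 (k - u.length - v.length) (by omega)).1 (e _ (by omega) (by omega))
            rw [← pA] at this
            rwa [show u.length + (k - u.length - v.length) + v.length = k by omega] at this
      · intro h
        obtain ⟨k, a, b, c, d⟩ := until_min hv pB h
        by_cases hh : k < u.length + v.length
        · refine ⟨k - u.length + 1, by omega, by omega, (h2.2 _ (by omega)).2 ?_,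
            Or.inl ⟨by omega, fun j hj hk => (hR1 j (by omega) (by omega)).2
              (d _ (by omega) (by omega))⟩⟩
          rwa [show u.length + (k - u.length) = k by omega]
        · refine ⟨k - u.length - v.length + 1, by omega, by omega, (h2.2 _ (by omega)).2 ?_,
            Or.inr ⟨by omega, fun j hj hk => (hR1 j (by omega) (by omega)).2 ?_,
              fun j hj hk => (hR1 j (by omega) (by omega)).2 (d _ (by omega) (by omega))⟩⟩
          · rw [← pB]
            rwa [show u.length + (k - u.length - v.length) + v.length = k by omega]
          · rw [← pA]
            exact d _ (by omega) (by omega)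

/--
For a lasso `(u,v)` (with `v` nonempty) and an LTL formula `φ`: for every
`1 ≤ i ≤ |u|`, `(u,v),(i,_) ⊨ φ` iff `u[i..]·v^ω ⊨ φ`, and for every
`1 ≤ j ≤ |v|`, `(u,v),(_,j) ⊨ φ` iff `v[j..]·v^ω ⊨ φ`.  In particular, for
nonempty `u`, `(u,v),(1,_) ⊨ φ` iff `u·v^ω ⊨ φ`.
-/
theorem lasso_position_semantics_correct (u v : List ℕ) (hv : v ≠ []) (φ : LTL) :
    (∀ i, 1 ≤ i → i ≤ u.length →
      (lsat u v φ (Sum.inl i) ↔ φ.sat (lassoWord (u.drop (i - 1)) v))) ∧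
    (∀ j, 1 ≤ j → j ≤ v.length →
      (lsat u v φ (Sum.inr j) ↔ φ.sat (lassoWord (v.drop (j - 1)) v))) ∧
    (u ≠ [] → (lsat u v φ (Sum.inl 1) ↔ φ.sat (lassoWord u v))) := by
  have hv' : 0 < v.length := List.length_pos_iff.2 hv
  obtain ⟨h1, h2⟩ := lsat_iff u v hv' φ
  refine ⟨fun i hi hi' => ?_, fun j hj hj' => ?_, fun hu => ?_⟩
  · have := h1 (i - 1) (by omega)
    rw [show i - 1 + 1 = i by omega] at this
    rw [this, lassoWord_dropU u v (i - 1) (by omega)]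
    rfl
  · have := h2 (j - 1) (by omega)
    rw [show j - 1 + 1 = j by omega] at this
    rw [this, lassoWord_dropV u v (j - 1) (by omega)]
    rfl
  · exact h1 0 (List.length_pos_iff.2 hu)

end Stmt9
end

section
/- Let W be a finite set, E ⊆ W×W a binary relation, and S ⊆ W. Let F : 𝒫(W) → 𝒫(W) be the monotone map F(X) = S ∩ {w : ∃w', E(w,w') and w' ∈ X}. Then the greatest fixpoint of F equals the set of nodes w ∈ W from which there exists an infinite E-path w = w₀, w₁, w₂, … (with E(w_k, w_{k+1}) for all k) such that w_k ∈ S for every k; moreover this greatest fixpoint equals F^{|W|}(W), the |W|-fold iterate of F applied to W. -/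
/-!
The greatest fixpoint of the `EG` map `X ↦ S ∩ {w | ∃ w', E w w' ∧ w' ∈ X}`
on a finite node set is the set of nodes admitting an infinite `E`-path
staying in `S`, and it is reached after `|W|` iterations from `W`.
-/

namespace Stmt10

theorem eg_gfp_characterization (W : Type) [Fintype W] (E : W → W → Prop)
    (S : Set W) (F : Set W →o Set W)
    (hF : ∀ X, F X = S ∩ {w | ∃ w', E w w' ∧ w' ∈ X}) :
    OrderHom.gfp F =
      {w | ∃ p : ℕ → W, p 0 = w ∧ (∀ k, E (p k) (p (k + 1))) ∧ ∀ k, p k ∈ S} ∧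
    OrderHom.gfp F = (⇑F)^[Fintype.card W] Set.univ := by
  constructor
  · apply le_antisymm
    · intro w hw
      have step : ∀ x : {z : W // z ∈ OrderHom.gfp F}, ∃ y : {z : W // z ∈ OrderHom.gfp F}, E x.1 y.1 := by
        rintro ⟨x, hx⟩
        rw [← OrderHom.map_gfp, hF] at hx
        obtain ⟨_, y, hxy, hy⟩ := hx
        exact ⟨⟨y, hy⟩, hxy⟩
      have hS : ∀ x : {z : W // z ∈ OrderHom.gfp F}, x.1 ∈ S := by
        rintro ⟨x, hx⟩
        rw [← OrderHom.map_gfp, hF] at hx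
        exact hx.1
      choose g hg using step
      refine ⟨fun k => (g^[k] ⟨w, hw⟩).1, rfl, fun k => ?_, fun k => hS _⟩
      simp only [Function.iterate_succ_apply']
      exact hg _
    · apply OrderHom.le_gfp
      rintro w ⟨p, rfl, hE, hS⟩
      rw [hF]
      exact ⟨hS 0, p 1, hE 0, fun k => p (k + 1), rfl, fun k => hE (k + 1), fun k => hS (k + 1)⟩
  · have hle : ∀ n, OrderHom.gfp F ≤ (⇑F)^[n] Set.univ := by
      intro n
      induction n with
      | zero => exact fun _ _ => trivial
      | succ n ih =>
        rw [Function.iterate_succ_apply', ← OrderHom.map_gfp]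
        exact F.monotone ih
    have hdec : ∀ n, F ((⇑F)^[n] Set.univ) ≤ (⇑F)^[n] Set.univ := by
      intro n
      induction n with
      | zero => exact fun _ _ => trivial
      | succ n ih =>
        rw [Function.iterate_succ_apply']
        exact F.monotone ih
    have key : ∀ n, F ((⇑F)^[n] Set.univ) = (⇑F)^[n] Set.univ ∨
        ((⇑F)^[n] Set.univ).ncard + n ≤ Fintype.card W := by
      intro n
      induction n with
      | zero => right; simp [Set.ncard_univ]
      | succ n ih =>
        rw [Function.iterate_succ_apply']
        by_cases h : F ((⇑F)^[n] Set.univ) = (⇑F)^[n] Set.univ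
        · left; rw [h, h]
        · right
          have h1 := ih.resolve_left h
          have h2 := Set.ncard_lt_ncard (lt_of_le_of_ne (hdec n) h) (Set.toFinite _)
          omega
    apply le_antisymm (hle _)
    apply OrderHom.le_gfp
    rcases key (Fintype.card W) with h | h
    · exact h.ge
    · have h0 : ((⇑F)^[Fintype.card W] Set.univ).ncard = 0 := by omega
      rw [Set.ncard_eq_zero (Set.toFinite _)] at h0
      rw [h0]
      exact Set.empty_subset _

end Stmt10
end

section
/- Let φ be a first-order formula (possibly with quantifiers) over the signature with a single binary relation symbol <, whose free variables are indexed by a finite set V, interpreted in the structure (ℚ,<). If γ, γ' : V → ℚ are two assignments such that for all x, y ∈ V, γ(x) ≤ γ(y) if and only if γ'(x) ≤ γ'(y), then (ℚ,<), γ ⊨ φ if and only if (ℚ,<), γ' ⊨ φ. That is, the truth of a first-order formula over the rationals with order depends only on the total preorder on the variables induced by the assignment. -/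
/-!
Truth of first-order formulas over `(ℚ, <)` depends only on the total
preorder on the (free) variables induced by the assignment.
-/

namespace Stmt12

/-- First-order formulas (with equality) over the signature with a single
binary relation symbol `<`, with free variables indexed by `V`; quantifiers
bind a fresh variable (`Option V`). -/
inductive Fml : Type → Type 1 where
  | lt {V : Type} : V → V → Fml V
  | eq {V : Type} : V → V → Fml V
  | and {V : Type} : Fml V → Fml V → Fml V
  | or {V : Type} : Fml V → Fml V → Fml V
  | not {V : Type} : Fml V → Fml V
  | all {V : Type} : Fml (Option V) → Fml V
  | ex {V : Type} : Fml (Option V) → Fml V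

/-- Standard Tarskian satisfaction in the structure `(ℚ, <)` under an
assignment `γ : V → ℚ`. -/
def Fml.sat : {V : Type} → (V → ℚ) → Fml V → Prop
  | _, γ, .lt x y => γ x < γ y
  | _, γ, .eq x y => γ x = γ y
  | _, γ, .and φ ψ => φ.sat γ ∧ ψ.sat γ
  | _, γ, .or φ ψ => φ.sat γ ∨ ψ.sat γ
  | _, γ, .not φ => ¬ φ.sat γ
  | _, γ, .all φ => ∀ q : ℚ, φ.sat (fun x => x.elim q γ)
  | _, γ, .ex φ => ∃ q : ℚ, φ.sat (fun x => x.elim q γ)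

theorem extend_aux {V : Type} [Finite V] (γ γ' : V → ℚ)
    (h : ∀ x y : V, γ x ≤ γ y ↔ γ' x ≤ γ' y) (q : ℚ) :
    ∃ q' : ℚ, ∀ x y : Option V,
      (x.elim q γ ≤ y.elim q γ ↔ x.elim q' γ' ≤ y.elim q' γ') := by
  classical
  haveI := Fintype.ofFinite V
  suffices H : ∃ q' : ℚ, ∀ x, (γ x ≤ q ↔ γ' x ≤ q') ∧ (q ≤ γ x ↔ q' ≤ γ' x) by
    obtain ⟨q', H⟩ := H
    refine ⟨q', ?_⟩
    rintro (_ | x) (_ | y)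
    · simp
    · exact (H y).2
    · exact (H x).1
    · exact h x y
  by_cases hq : ∃ v, γ v = q
  · obtain ⟨v, rfl⟩ := hq
    exact ⟨γ' v, fun x => ⟨h x v, h v x⟩⟩
  · push Not at hq
    obtain ⟨q', h1, h2⟩ := Order.exists_between_finsets
      (lo := (Finset.univ.filter (fun v => γ v < q)).image γ')
      (hi := (Finset.univ.filter (fun v => q < γ v)).image γ') (by
        intro a ha b hb
        simp only [Finset.mem_image, Finset.mem_filter, Finset.mem_univ, true_and] at ha hb
        obtain ⟨x, hx, rfl⟩ := ha
        obtain ⟨y, hy, rfl⟩ := hb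
        rw [← not_le, ← h, not_le]
        exact hx.trans hy)
    refine ⟨q', fun x => ?_⟩
    rcases lt_or_gt_of_ne (hq x) with hx | hx
    · have := h1 (γ' x) (Finset.mem_image_of_mem _ (by simpa using hx))
      simp [hx.le, this.le, hx.not_ge, this.not_ge]
    · have := h2 (γ' x) (Finset.mem_image_of_mem _ (by simpa using hx))
      simp [hx.le, this.le, hx.not_ge, this.not_ge]

theorem sat_aux {V : Type} (φ : Fml V) : Finite V → ∀ (γ γ' : V → ℚ)
    (_ : ∀ x y : V, γ x ≤ γ y ↔ γ' x ≤ γ' y), (φ.sat γ ↔ φ.sat γ') := by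
  induction φ with
  | lt x y =>
    intro _ γ γ' h
    simp only [Fml.sat, ← not_le, h]
  | eq x y =>
    intro _ γ γ' h
    simp only [Fml.sat, le_antisymm_iff, h]
  | and a b iha ihb =>
    intro hf γ γ' h
    simp only [Fml.sat, iha hf γ γ' h, ihb hf γ γ' h]
  | or a b iha ihb =>
    intro hf γ γ' h
    simp only [Fml.sat, iha hf γ γ' h, ihb hf γ γ' h]
  | not a iha =>
    intro hf γ γ' h
    simp only [Fml.sat, iha hf γ γ' h]
  | all a ih =>
    intro hf γ γ' h
    simp only [Fml.sat]
    constructor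
    · intro H q
      obtain ⟨q', hq⟩ := extend_aux γ' γ (fun x y => (h x y).symm) q
      exact (ih inferInstance _ _ hq).2 (H q')
    · intro H q
      obtain ⟨q', hq⟩ := extend_aux γ γ' h q
      exact (ih inferInstance _ _ hq).2 (H q')
  | ex a ih =>
    intro hf γ γ' h
    simp only [Fml.sat]
    constructor
    · rintro ⟨q, H⟩
      obtain ⟨q', hq⟩ := extend_aux γ γ' h q
      exact ⟨q', (ih inferInstance _ _ hq).1 H⟩
    · rintro ⟨q, H⟩
      obtain ⟨q', hq⟩ := extend_aux γ' γ (fun x y => (h x y).symm) q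
      exact ⟨q', (ih inferInstance _ _ hq).1 H⟩

/--
If two assignments `γ, γ' : V → ℚ` (for a finite set `V` of variables)
induce the same total preorder on `V` — i.e. `γ x ≤ γ y ↔ γ' x ≤ γ' y` for
all `x, y ∈ V` — then they satisfy the same first-order formulas
over `(ℚ, <)`.
-/
theorem fo_rationals_order_invariance (V : Type) [Finite V] (φ : Fml V)
    (γ γ' : V → ℚ) (h : ∀ x y : V, γ x ≤ γ y ↔ γ' x ≤ γ' y) :
    φ.sat γ ↔ φ.sat γ' := by
  exact sat_aux φ inferInstance γ γ' h

end Stmt12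
end

section
/- Let V be a finite set, x ∈ V, γ : V → ℚ an assignment, and ≿' a total preorder on V (a reflexive, transitive, total relation) such that for all y, z ∈ V∖{x}, y ≿' z if and only if γ(y) ≥ γ(z). Then there exists q ∈ ℚ such that the updated assignment γ[x↦q] induces ≿', i.e., for all y, z ∈ V, y ≿' z if and only if γ[x↦q](y) ≥ γ[x↦q](z). -/
/-!
Every total preorder on a finite variable set that agrees with a given
rational assignment off `x` is realized by updating the assignment at `x`
(density / no endpoints of `ℚ`).
-/

namespace Stmt13

theorem place_preorder_realizable (V : Type) [Finite V] [DecidableEq V]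
    (x : V) (γ : V → ℚ) (r : V → V → Prop)
    (hrefl : ∀ y, r y y)
    (htrans : ∀ a b c, r a b → r b c → r a c)
    (htotal : ∀ y z, r y z ∨ r z y)
    (hagree : ∀ y z, y ≠ x → z ≠ x → (r y z ↔ γ z ≤ γ y)) :
    ∃ q : ℚ, ∀ y z,
      r y z ↔ Function.update γ x q z ≤ Function.update γ x q y := by
  suffices h : ∃ q : ℚ, ∀ y, y ≠ x → ((r y x ↔ q ≤ γ y) ∧ (r x y ↔ γ y ≤ q)) by
    obtain ⟨q, hq⟩ := h
    refine ⟨q, fun y z => ?_⟩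
    by_cases hy : y = x
    · by_cases hz : z = x
      · subst hy; subst hz; simp [hrefl]
      · subst hy; simp [Function.update_of_ne hz, (hq z hz).2]
    · by_cases hz : z = x
      · subst hz; simp [Function.update_of_ne hy, (hq y hy).1]
      · simp [Function.update_of_ne hy, Function.update_of_ne hz, hagree y z hy hz]
  by_cases hw : ∃ w, w ≠ x ∧ r w x ∧ r x w
  · obtain ⟨w, hwx, h1, h2⟩ := hw
    refine ⟨γ w, fun y hy => ⟨?_, ?_⟩⟩
    · rw [← hagree y w hy hwx]
      exact ⟨fun h => htrans _ _ _ h h2, fun h => htrans _ _ _ h h1⟩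
    · rw [← hagree w y hwx hy]
      exact ⟨fun h => htrans _ _ _ h1 h, fun h => htrans _ _ _ h2 h⟩
  · push Not at hw
    have hlo : (γ '' {y | y ≠ x ∧ r x y}).Finite := Set.toFinite _
    have hhi : (γ '' {y | y ≠ x ∧ r y x}).Finite := Set.toFinite _
    obtain ⟨q, hq1, hq2⟩ := Order.exists_between_finsets hlo.toFinset hhi.toFinset (by
      intro a ha b hb
      rw [Set.Finite.mem_toFinset] at ha hb
      obtain ⟨y, ⟨hy, hxy⟩, rfl⟩ := ha
      obtain ⟨z, ⟨hz, hzx⟩, rfl⟩ := hb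
      by_contra hcon
      have hyz := (hagree y z hy hz).2 (not_lt.1 hcon)
      exact hw y hy (htrans _ _ _ hyz hzx) hxy)
    have h1 : ∀ y, y ≠ x → r x y → γ y < q := fun y hy h =>
      hq1 _ (hlo.mem_toFinset.2 ⟨y, ⟨hy, h⟩, rfl⟩)
    have h2 : ∀ y, y ≠ x → r y x → q < γ y := fun y hy h =>
      hq2 _ (hhi.mem_toFinset.2 ⟨y, ⟨hy, h⟩, rfl⟩)
    refine ⟨q, fun y hy => ⟨⟨fun h => (h2 y hy h).le, fun h => ?_⟩,
      ⟨fun h => (h1 y hy h).le, fun h => ?_⟩⟩⟩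
    · exact (htotal y x).resolve_right fun h' => absurd (h1 y hy h') (not_lt.2 h)
    · exact (htotal y x).resolve_left fun h' => absurd (h2 y hy h') (not_lt.2 h)

end Stmt13
end
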